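/- arXiv:math/0607825 — 3 statements merged into one kernel-verified Lean document; each statement's English description precedes it below -/
import Mathlib

section
/- For any two points p₀ = (g₀, h₀) and p₁ = (g₁, h₁) in ℝ² with p₀ ≠ (0,0) and p₁ ≠ (0,0), there exists a C^∞ curve γ = (g, h) : [0,1] → ℝ² with γ(0) = p₀, γ(1) = p₁, and g(s)·h'(s) − h(s)·g'(s) > 0 for every s ∈ [0,1]. In particular γ(s) ≠ (0,0) for all s. -/
lemma polar_aux (p : ℝ × ℝ) (h : p ≠ 0) :
    ∃ a c : ℝ, -Real.pi < c ∧ c ≤ Real.pi ∧ Real.exp a * Real.cos c = p.1 ∧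
      Real.exp a * Real.sin c = p.2 := by
  have hz : (⟨p.1, p.2⟩ : ℂ) ≠ 0 := by
    intro hz
    apply h
    have h1 := congrArg Complex.re hz
    have h2 := congrArg Complex.im hz
    exact Prod.ext h1 h2
  refine ⟨Real.log ‖(⟨p.1, p.2⟩ : ℂ)‖, Complex.arg ⟨p.1, p.2⟩, Complex.neg_pi_lt_arg _,
    Complex.arg_le_pi _, ?_, ?_⟩
  · rw [Real.exp_log (norm_pos_iff.mpr hz), Complex.norm_mul_cos_arg]
  · rw [Real.exp_log (norm_pos_iff.mpr hz), Complex.norm_mul_sin_arg]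

/-- For any two nonzero points of `ℝ²` there is a `C^∞` curve `γ = (g, h)`
joining them with `g h' − h g' > 0` on `[0,1]`; in particular the curve never
passes through the origin. -/
theorem exists_contact_interpolating_curve (p₀ p₁ : ℝ × ℝ)
    (h₀ : p₀ ≠ 0) (h₁ : p₁ ≠ 0) :
    ∃ g h : ℝ → ℝ, ContDiff ℝ (⊤ : ℕ∞) g ∧ ContDiff ℝ (⊤ : ℕ∞) h ∧
      (g 0, h 0) = p₀ ∧ (g 1, h 1) = p₁ ∧
      (∀ s ∈ Set.Icc (0 : ℝ) 1, 0 < g s * deriv h s - h s * deriv g s) ∧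
      (∀ s ∈ Set.Icc (0 : ℝ) 1, (g s, h s) ≠ (0, 0)) := by
  obtain ⟨a, c, hc1, hc2, hx, hy⟩ := polar_aux p₀ h₀
  obtain ⟨a', c', hc1', hc2', hx', hy'⟩ := polar_aux p₁ h₁
  have hpi := Real.pi_pos
  obtain ⟨b, hb⟩ : ∃ b, b = a' - a := ⟨_, rfl⟩
  obtain ⟨d, hd⟩ : ∃ d, d = c' - c + 2 * Real.pi + 2 * Real.pi := ⟨_, rfl⟩
  have hdpos : 0 < d := by linarith
  have e1 : a + b * 1 = a' := by rw [hb]; ring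
  have e2 : c + d * 1 = c' + 2 * Real.pi + 2 * Real.pi := by rw [hd]; ring
  have key : ∀ s : ℝ, 0 < (Real.exp (a + b * s) * Real.cos (c + d * s)) *
        deriv (fun s => Real.exp (a + b * s) * Real.sin (c + d * s)) s -
      (Real.exp (a + b * s) * Real.sin (c + d * s)) *
        deriv (fun s => Real.exp (a + b * s) * Real.cos (c + d * s)) s := by
    intro s
    have l1 : HasDerivAt (fun s : ℝ => a + b * s) b s := by
      simpa using ((hasDerivAt_id s).const_mul b).const_add a
    have l2 : HasDerivAt (fun s : ℝ => c + d * s) d s := by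
      simpa using ((hasDerivAt_id s).const_mul d).const_add c
    have D1 := (l1.exp.mul l2.sin).deriv
    have D2 := (l1.exp.mul l2.cos).deriv
    have D1' : deriv (fun s => Real.exp (a + b * s) * Real.sin (c + d * s)) s = _ := D1
    have D2' : deriv (fun s => Real.exp (a + b * s) * Real.cos (c + d * s)) s = _ := D2
    rw [D1', D2']
    have : 0 < Real.exp (a + b * s) ^ 2 * d := by positivity
    have t := Real.sin_sq_add_cos_sq (c + d * s)
    calc 0 < Real.exp (a + b * s) ^ 2 * d := this
      _ = Real.exp (a + b * s) ^ 2 * d * (Real.sin (c + d * s) ^ 2 + Real.cos (c + d * s) ^ 2) := by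
        rw [t, mul_one]
      _ = _ := by ring
  refine ⟨fun s => Real.exp (a + b * s) * Real.cos (c + d * s),
    fun s => Real.exp (a + b * s) * Real.sin (c + d * s), by fun_prop, by fun_prop,
    ?_, ?_, fun s _ => key s, ?_⟩
  · simp [hx, hy]
  · simp only [e1, e2, Real.cos_add_two_pi, Real.sin_add_two_pi, hx', hy']
  · intro s _ h
    have k := key s
    have h1 : Real.exp (a + b * s) * Real.cos (c + d * s) = 0 := congrArg Prod.fst h
    have h2 : Real.exp (a + b * s) * Real.sin (c + d * s) = 0 := congrArg Prod.snd h
    rw [h1, h2] at k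
    simp at k
end

section
/- Let t > 0 and ε > 0, and let f : ℝ → ℝ be a C^∞ function with f(r) > −1 and f'(r) < 0 for all r. Then there exist C^∞ functions g, h : ℝ → ℝ such that: (i) g(r) = t·(1 + f(r)) and h(r) = 1 + t·r² for all r in some neighborhood of r = 1+ε; (ii) g(r) = −t·r and h(r) = 1 for all r in some neighborhood of r = 1+2ε; (iii) g(r)·h'(r) − h(r)·g'(r) > 0 for all r ∈ [1+ε, 1+2ε]; and (iv) g'(r) < 0 for all r ∈ [1+ε, 1+2ε]. -/
lemma exp_inv_monotone : Monotone expNegInvGlue := by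
  intro x y hxy
  unfold expNegInvGlue
  by_cases hx : x ≤ 0
  · rw [if_pos hx]
    split_ifs
    · exact le_rfl
    · exact (Real.exp_pos _).le
  · have hy : ¬ y ≤ 0 := by linarith
    rw [if_neg hx, if_neg hy]
    push Not at hx
    exact Real.exp_le_exp.mpr (neg_le_neg (inv_anti₀ hx hxy))

lemma smooth_transition_monotone : Monotone Real.smoothTransition := by
  intro x y hxy
  unfold Real.smoothTransition
  rw [div_le_div_iff₀ (Real.smoothTransition.pos_denom x) (Real.smoothTransition.pos_denom y)]
  have h1 := exp_inv_monotone hxy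
  have h2 : expNegInvGlue (1 - y) ≤ expNegInvGlue (1 - x) := exp_inv_monotone (by linarith)
  have := mul_le_mul h1 h2 (expNegInvGlue.nonneg _) (expNegInvGlue.nonneg _)
  nlinarith

lemma exists_step (p q : ℝ) (hpq : p < q) : ∃ χ : ℝ → ℝ, ContDiff ℝ (⊤ : ℕ∞) χ ∧
    (∀ x, 0 ≤ χ x) ∧ (∀ x, χ x ≤ 1) ∧ (∀ x, 0 ≤ deriv χ x) ∧
    (∀ x, x ≤ p → χ x = 0) ∧ (∀ x, q ≤ x → χ x = 1) := by
  have hd : 0 < q - p := by linarith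
  refine ⟨fun x => Real.smoothTransition ((x - p) / (q - p)), ?_, ?_, ?_, ?_, ?_, ?_⟩
  · exact Real.smoothTransition.contDiff.comp ((contDiff_id.sub contDiff_const).div_const _)
  · exact fun x => Real.smoothTransition.nonneg _
  · exact fun x => Real.smoothTransition.le_one _
  · intro x
    apply Monotone.deriv_nonneg
    intro x y hxy
    apply smooth_transition_monotone
    gcongr
  · intro x hx
    exact Real.smoothTransition.zero_of_nonpos (div_nonpos_of_nonpos_of_nonneg (by linarith) hd.le)
  · intro x hx
    exact Real.smoothTransition.one_of_one_le ((one_le_div hd).mpr (by linarith))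


/-- Gluing region interpolation: there exist `C^∞` functions `g, h` agreeing with
the coefficients of `α_t` near `r = 1+ε`, with those of `Ψ*β_t` near `r = 1+2ε`,
satisfying the contact condition `g h' − h g' > 0` and `g' < 0` on `[1+ε, 1+2ε]`. -/
theorem exists_gluing_functions (t ε : ℝ) (ht : 0 < t) (hε : 0 < ε)
    (f : ℝ → ℝ) (hf : ContDiff ℝ (⊤ : ℕ∞) f)
    (hf1 : ∀ r : ℝ, -1 < f r) (hf2 : ∀ r : ℝ, deriv f r < 0) :
    ∃ g h : ℝ → ℝ, ContDiff ℝ (⊤ : ℕ∞) g ∧ ContDiff ℝ (⊤ : ℕ∞) h ∧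
      (∀ᶠ r in nhds (1 + ε), g r = t * (1 + f r) ∧ h r = 1 + t * r ^ 2) ∧
      (∀ᶠ r in nhds (1 + 2 * ε), g r = -(t * r) ∧ h r = 1) ∧
      (∀ r ∈ Set.Icc (1 + ε) (1 + 2 * ε), 0 < g r * deriv h r - h r * deriv g r) ∧
      (∀ r ∈ Set.Icc (1 + ε) (1 + 2 * ε), deriv g r < 0) := by
  obtain ⟨χ, χs, χ0, χ1, χd, χl, χr⟩ := exists_step (1 + 5/4*ε) (1 + 7/4*ε) (by linarith)
  have hdiff : ∀ {u : ℝ → ℝ}, ContDiff ℝ (⊤ : ℕ∞) u → ∀ x, HasDerivAt u (deriv u x) x :=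
    fun hu x => ((hu.differentiable (by simp)) x).hasDerivAt
  obtain ⟨g, hg⟩ : ∃ g : ℝ → ℝ, g = fun r => (1 - χ r) * (t * (1 + f r)) + χ r * (-(t * r)) :=
    ⟨_, rfl⟩
  have gs : ContDiff ℝ (⊤ : ℕ∞) g := by
    rw [hg]
    fun_prop
  have gd : ∀ r, 0 < r → deriv g r < 0 := by
    intro r hr
    have h1 : HasDerivAt g ((0 - deriv χ r) * (t * (1 + f r)) + (1 - χ r) * (t * (0 + deriv f r))
        + (deriv χ r * (-(t * r)) + χ r * (-(t * 1)))) r := by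
      rw [hg]
      exact (((hasDerivAt_const r (1:ℝ)).sub (hdiff χs r)).mul
        (((hasDerivAt_const r (1:ℝ)).add (hdiff hf r)).const_mul t)).add
        ((hdiff χs r).mul (((hasDerivAt_id r).const_mul t).neg))
    rw [h1.deriv]
    have e1 : 0 ≤ deriv χ r * (t * (1 + f r)) :=
      mul_nonneg (χd r) (mul_nonneg ht.le (by linarith [hf1 r]))
    have e2 : 0 ≤ deriv χ r * (t * r) := mul_nonneg (χd r) (mul_nonneg ht.le hr.le)
    have e3 : 0 < (1 - χ r) * (t * (- deriv f r)) + χ r * t := by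
      have k1 : 0 < t * (- deriv f r) := mul_pos ht (by linarith [hf2 r])
      rcases (χ0 r).eq_or_lt with h | h
      · rw [← h]; linarith
      · have := mul_nonneg (sub_nonneg.mpr (χ1 r)) k1.le
        have := mul_pos h ht
        linarith
    linarith
  have ga : StrictAntiOn g (Set.Ioi 0) := by
    apply strictAntiOn_of_deriv_neg (convex_Ioi 0) gs.continuous.continuousOn
    intro x hx
    rw [interior_Ioi] at hx
    exact gd x hx
  have gl : ∀ r, r ≤ 1 + 5/4*ε → g r = t * (1 + f r) := by
    intro r hr
    simp [hg, χl r hr]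
  have gr : ∀ r, 1 + 7/4*ε ≤ r → g r = -(t * r) := by
    intro r hr
    simp [hg, χr r hr]
  obtain ⟨c, ⟨hca, hcb⟩, hc⟩ : ∃ c ∈ Set.Ioo (1 + ε) (1 + 2 * ε), g c = 0 := by
    apply intermediate_value_Ioo' (by linarith) gs.continuous.continuousOn
    rw [gl (1 + ε) (by linarith), gr (1 + 2 * ε) (by linarith)]
    refine ⟨?_, mul_pos ht (by linarith [hf1 (1 + ε)])⟩
    have : 0 < t * (1 + 2 * ε) := by positivity
    linarith
  obtain ⟨u, us, u0, u1, ud, ul, ur⟩ := exists_step ((1 + ε + c)/2) c (by linarith)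
  obtain ⟨v, vs, v0, v1, vd, vl, vr⟩ := exists_step c ((1 + 2 * ε + c)/2) (by linarith)
  obtain ⟨h, hh⟩ : ∃ h : ℝ → ℝ,
      h = fun r => 1 + t * (((1 - u r) * r ^ 2 + u r * c ^ 2) * (1 - v r)) := ⟨_, rfl⟩
  have hs : ContDiff ℝ (⊤ : ℕ∞) h := by
    rw [hh]
    fun_prop
  have hpos : ∀ r, 0 < h r := by
    intro r
    have a1 := sub_nonneg.mpr (u1 r)
    have a2 := sub_nonneg.mpr (v1 r)
    have a3 := u0 r
    rw [hh]
    positivity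
  have hd : ∀ r, deriv h r = t * ((((0 - deriv u r) * r ^ 2 + (1 - u r) * (2 * r))
      + deriv u r * c ^ 2) * (1 - v r)
      + ((1 - u r) * r ^ 2 + u r * c ^ 2) * (0 - deriv v r)) := by
    intro r
    have hsq : HasDerivAt (fun r : ℝ => r ^ 2) (2 * r) r := by
      simpa using hasDerivAt_pow 2 r
    rw [hh]
    exact ((((((hasDerivAt_const r (1:ℝ)).sub (hdiff us r)).mul hsq).add
      ((hdiff us r).mul_const (c ^ 2))).mul
      ((hasDerivAt_const r (1:ℝ)).sub (hdiff vs r))).const_mul t).const_add 1 |>.deriv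
  refine ⟨g, h, gs, hs, ?_, ?_, ?_, ?_⟩
  · filter_upwards [Iio_mem_nhds (show 1 + ε < 1 + 5/4*ε by linarith),
      Iio_mem_nhds (show 1 + ε < (1 + ε + c)/2 by linarith)] with r h1 h2
    simp only [Set.mem_Iio] at h1 h2
    refine ⟨gl r h1.le, ?_⟩
    simp [hh, ul r h2.le, vl r (by linarith)]
  · filter_upwards [Ioi_mem_nhds (show 1 + 7/4*ε < 1 + 2*ε by linarith),
      Ioi_mem_nhds (show (1 + 2 * ε + c)/2 < 1 + 2*ε by linarith)] with r h1 h2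
    simp only [Set.mem_Ioi] at h1 h2
    refine ⟨gr r h1.le, ?_⟩
    simp [hh, vr r h2.le]
  · rintro r ⟨hr1, hr2⟩
    have hr : 0 < r := by linarith
    have hc0 : 0 < c := by linarith
    have key : 0 ≤ g r * deriv h r := by
      rcases lt_trichotomy r c with hlt | heq | hgt
      · have hgr : 0 < g r := by rw [← hc]; exact ga hr hc0 hlt
        have hv : deriv v r = 0 := by
          have : v =ᶠ[nhds r] fun _ => (0:ℝ) := by
            filter_upwards [Iio_mem_nhds hlt] with x hx using vl x (le_of_lt hx)
          rw [this.deriv_eq]; simp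
        apply mul_nonneg hgr.le
        rw [hd, hv, vl r hlt.le]
        have b1 : 0 ≤ deriv u r * (c ^ 2 - r ^ 2) := mul_nonneg (ud r) (by nlinarith)
        have b2 : 0 ≤ (1 - u r) * (2 * r) := mul_nonneg (sub_nonneg.mpr (u1 r)) (by linarith)
        apply mul_nonneg ht.le
        linarith
      · rw [heq, hc]; simp
      · have hgr : g r < 0 := by rw [← hc]; exact ga hc0 hr hgt
        have hu : deriv u r = 0 := by
          have : u =ᶠ[nhds r] fun _ => (1:ℝ) := by
            filter_upwards [Ioi_mem_nhds hgt] with x hx using ur x (le_of_lt hx)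
          rw [this.deriv_eq]; simp
        apply mul_nonneg_of_nonpos_of_nonpos hgr.le
        rw [hd, hu, ur r hgt.le]
        have b1 : 0 ≤ c ^ 2 * deriv v r := mul_nonneg (sq_nonneg c) (vd r)
        apply mul_nonpos_of_nonneg_of_nonpos ht.le
        linarith
    have := mul_pos_of_neg_of_neg (gd r hr) (neg_neg_of_pos (hpos r))
    linarith
  · rintro r ⟨hr1, hr2⟩
    exact gd r (by linarith)
end

section
/- Fix real numbers t and ε. Define Ψ : ℝ³ → ℝ³ by Ψ(r, θ, φ) = (r − 1 − ε, −φ, θ), and for each point q = (s, θ', z) ∈ ℝ³ define the continuous linear functional β(q) : ℝ³ → ℝ by β(q)(v₁, v₂, v₃) = v₃ + t·(1 + ε + s)·v₂. Then Ψ is C^∞, and for every point p = (r, θ, φ) ∈ ℝ³ and every vector v = (v₁, v₂, v₃) ∈ ℝ³, the pullback satisfies β(Ψ(p))( (DΨ)ₚ v ) = v₂ − t·r·v₃, where (DΨ)ₚ denotes the (Fréchet) derivative of Ψ at p. -/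
/-- The gluing map `Ψ(r,θ,φ) = (r−1−ε, −φ, θ)` is `C^∞`, and the pullback of the
Thurston–Winkelnkemper form `β = dz + t(1+ε+s) dθ` under `Ψ` is `dθ − t r dφ`. -/
theorem pullback_TW_form (t ε : ℝ)
    (Ψ : ℝ × ℝ × ℝ → ℝ × ℝ × ℝ)
    (hΨ : ∀ p : ℝ × ℝ × ℝ, Ψ p = (p.1 - 1 - ε, -p.2.2, p.2.1))
    (β : ℝ × ℝ × ℝ → (ℝ × ℝ × ℝ →L[ℝ] ℝ))
    (hβ : ∀ q v : ℝ × ℝ × ℝ, β q v = v.2.2 + t * (1 + ε + q.1) * v.2.1) :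
    ContDiff ℝ (⊤ : ℕ∞) Ψ ∧
      ∀ (p v : ℝ × ℝ × ℝ), β (Ψ p) (fderiv ℝ Ψ p v) = v.2.1 - t * p.1 * v.2.2 := by
  have hfun : Ψ = fun p : ℝ × ℝ × ℝ => (p.1 - 1 - ε, -p.2.2, p.2.1) := funext hΨ
  refine ⟨by rw [hfun]; fun_prop, fun p v => ?_⟩
  have h1 : HasFDerivAt (fun p : ℝ × ℝ × ℝ => p.1) (ContinuousLinearMap.fst ℝ ℝ (ℝ × ℝ)) p :=
    hasFDerivAt_fst
  have h2 : HasFDerivAt (fun p : ℝ × ℝ × ℝ => p.2.1)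
      ((ContinuousLinearMap.fst ℝ ℝ ℝ).comp (ContinuousLinearMap.snd ℝ ℝ (ℝ × ℝ))) p :=
    ((ContinuousLinearMap.fst ℝ ℝ ℝ).comp (ContinuousLinearMap.snd ℝ ℝ (ℝ × ℝ))).hasFDerivAt
  have h3 : HasFDerivAt (fun p : ℝ × ℝ × ℝ => p.2.2)
      ((ContinuousLinearMap.snd ℝ ℝ ℝ).comp (ContinuousLinearMap.snd ℝ ℝ (ℝ × ℝ))) p :=
    ((ContinuousLinearMap.snd ℝ ℝ ℝ).comp (ContinuousLinearMap.snd ℝ ℝ (ℝ × ℝ))).hasFDerivAt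
  have h := ((h1.sub_const 1).sub_const ε).prodMk (h3.fun_neg.prodMk h2)
  rw [← hfun] at h
  rw [h.fderiv, hβ, hΨ]
  simp
  ring
end
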